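/- The right ℤ[F]-module C¹ is finitely presented. -/

import Mathlib

open scoped BigOperators

namespace DecompPaper

variable (B : Type) [DecidableEq B]

/-- The set of letters `B ⊔ B⁻¹` carries the discrete topology. -/
instance : TopologicalSpace (B × Bool) := ⊥

/-- The Gromov boundary `∂F` of the free group on `B`: the space of infinite reduced
words, i.e. sequences of letters with no cancelling adjacent pair, topologized as a
subspace of the product of discrete spaces. -/
abbrev Boundary : Type :=
  {s : ℕ → B × Bool // ∀ k, s (k + 1) ≠ ((s k).1, !(s k).2)}

/-- The prefix of length `m` of an infinite reduced word, as an element of the free group. -/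
def prefixOf (ξ : Boundary B) (m : ℕ) : FreeGroup B :=
  FreeGroup.mk (List.ofFn fun i : Fin m => ξ.1 i)

/-- Adjacency in the Cayley graph `T` of the free group with respect to `B`. -/
def Adj (g h : FreeGroup B) : Prop :=
  ∃ x : B × Bool, h = g * FreeGroup.mk [x]

/-- A set of vertices of `T` is a subtree iff any two of its vertices are joined by a
path in the Cayley graph staying inside the set. -/
def IsSubtree (X : Set (FreeGroup B)) : Prop :=
  ∀ g ∈ X, ∀ h ∈ X, Relation.ReflTransGen (fun a b => Adj B a b ∧ b ∈ X) g h

/-- `C` is a connected component of `T ∖ X`. -/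
def IsComponentOf (X C : Set (FreeGroup B)) : Prop :=
  ∃ v, v ∉ X ∧
    C = {u | Relation.ReflTransGen (fun a b => Adj B a b ∧ a ∉ X ∧ b ∉ X) v u}

/-- `∂C`: the set of boundary points all of whose sufficiently long prefixes lie in `C`. -/
def boundaryOf (C : Set (FreeGroup B)) : Set (Boundary B) :=
  {ξ | ∃ m, ∀ k, m ≤ k → prefixOf B ξ k ∈ C}

/-- The sequence `a` of group elements converges to the boundary point `ξ`:
every prefix of `ξ` is eventually an initial segment of the reduced word of `a k`. -/
def TendstoBoundary (a : ℕ → FreeGroup B) (ξ : Boundary B) : Prop :=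
  ∀ m : ℕ, ∃ K, ∀ k, K ≤ k → (List.ofFn fun i : Fin m => ξ.1 i) <+: (a k).toWord

/-- `{ξ, η}` is a line of the line pattern generated by the words `w i`: for some
`g` and `i`, `ξ` and `η` are the limits of `g * (w i) ^ k` as `k → +∞` and `k → -∞`
(in one of the two orders). -/
def IsLine {r : ℕ} (w : Fin r → FreeGroup B) (ξ η : Boundary B) : Prop :=
  ∃ (g : FreeGroup B) (i : Fin r),
    (TendstoBoundary B (fun k => g * w i ^ k) ξ ∧
       TendstoBoundary B (fun k => g * (w i)⁻¹ ^ k) η) ∨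
    (TendstoBoundary B (fun k => g * w i ^ k) η ∧
       TendstoBoundary B (fun k => g * (w i)⁻¹ ^ k) ξ)

/-- Malnormality of the family of cyclic subgroups `⟨w i⟩`. -/
def Malnormal {r : ℕ} (w : Fin r → FreeGroup B) : Prop :=
  ∀ (g : FreeGroup B) (i j : Fin r),
    (∃ x : FreeGroup B, x ∈ Subgroup.zpowers (w i) ∧ x ≠ 1 ∧
        g * x * g⁻¹ ∈ Subgroup.zpowers (w j)) →
      i = j ∧ g ∈ Subgroup.zpowers (w i)

/-- The decomposition space `D`: the quotient of `∂F` by the smallest equivalence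
relation identifying the two endpoints of each line, with the quotient topology. -/
abbrev DSpace {r : ℕ} (w : Fin r → FreeGroup B) : Type :=
  Quot (IsLine B w)

/-- The quotient projection `q : ∂F → D`. -/
def qmap {r : ℕ} (w : Fin r → FreeGroup B) : Boundary B → DSpace B w :=
  Quot.mk _

/-- The geodesic of the line with endpoints `ξ` and `η`: all prefixes of `ξ` or of `η`
of length at least the length of their longest common initial segment. -/
def lineGeodesic (ξ η : Boundary B) : Set (FreeGroup B) :=
  {g | ∃ k : ℕ, (g = prefixOf B ξ k ∨ g = prefixOf B η k) ∧ ∃ i ≤ k, ξ.1 i ≠ η.1 i}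

/-- The line with endpoints `ξ, η` passes through the subtree `X`. -/
def PassesThrough (ξ η : Boundary B) (X : Set (FreeGroup B)) : Prop :=
  ∃ g ∈ X, g ∈ lineGeodesic B ξ η

/-- A function `σ : D → ℤ` is supported on the subtree `X` if `σ ∘ q` is constant on
`∂C` for every connected component `C` of `T ∖ X`. -/
def SupportedOn {r : ℕ} (w : Fin r → FreeGroup B) (σ : DSpace B w → ℤ)
    (X : Set (FreeGroup B)) : Prop :=
  ∀ C : Set (FreeGroup B), IsComponentOf B X C →
    ∀ ξ, ξ ∈ boundaryOf B C → ∀ η, η ∈ boundaryOf B C →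
      σ (qmap B w ξ) = σ (qmap B w η)

/-- Prepending a letter to an infinite reduced word, cancelling if necessary. -/
def consB (x : B × Bool) (ξ : Boundary B) : Boundary B :=
  if h : ξ.1 0 = (x.1, !x.2) then
    ⟨fun k => ξ.1 (k + 1), fun k => ξ.2 (k + 1)⟩
  else
    ⟨fun k => Nat.rec x (fun j _ => ξ.1 j) k, by
      intro k
      cases k with
      | zero => exact h
      | succ j => exact ξ.2 j⟩

/-- The action of the free group on its boundary: left multiplication followed by
reduction. -/
def actB (g : FreeGroup B) (ξ : Boundary B) : Boundary B :=
  g.toWord.foldr (consB B) ξ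

/-- The induced action of the free group on the decomposition space. -/
noncomputable def actD {r : ℕ} (w : Fin r → FreeGroup B) (g : FreeGroup B)
    (x : DSpace B w) : DSpace B w :=
  qmap B w (actB B g (Quot.out x))

/-- The map `p : (ℤ[F])^k → C(D, ℤ)` of right `ℤ[F]`-modules determined by generators
`σ j`, where an element of the free module `(ℤ[F])^k` is recorded as a finitely
supported function `(Fin k × F) →₀ ℤ` and `e_j · g` is sent to `σ j · g`. -/
noncomputable def pMap {r : ℕ} (w : Fin r → FreeGroup B) {k : ℕ}
    (σ : Fin k → DSpace B w → ℤ) (x : (Fin k × FreeGroup B) →₀ ℤ) :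
    DSpace B w → ℤ :=
  fun d => x.sum fun p n => n * σ p.1 (actD B w p.2 d)

/-- Right translation by `g` on the free module `(ℤ[F])^k`, sending `e_j · h` to
`e_j · (h * g)`. -/
noncomputable def fsTranslate {k : ℕ} (y : (Fin k × FreeGroup B) →₀ ℤ)
    (g : FreeGroup B) : (Fin k × FreeGroup B) →₀ ℤ :=
  Finsupp.mapDomain (fun p => (p.1, p.2 * g)) y

/-- The convex hull of a set of vertices of `T`: the smallest subtree containing it. -/
def hull (S : Set (FreeGroup B)) : Set (FreeGroup B) :=
  ⋂₀ {Y : Set (FreeGroup B) | IsSubtree B Y ∧ S ⊆ Y}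

/-- The support of an element of the free module `(ℤ[F])^k`, relative to supports
`X j` of the generators: the convex hull of the union of the sets `g⁻¹ • X j` over
the pairs `(j, g)` appearing with nonzero coefficient. -/
def fsSupport {k : ℕ} (X : Fin k → Set (FreeGroup B))
    (x : (Fin k × FreeGroup B) →₀ ℤ) : Set (FreeGroup B) :=
  hull B (⋃ p ∈ x.support, (fun v => p.2⁻¹ * v) '' X p.1)

/-- Antisymmetry of a `1`-cochain on oriented lines. -/
def Antisym {r : ℕ} (w : Fin r → FreeGroup B)
    (f : Boundary B → Boundary B → ℤ) : Prop :=
  ∀ ξ η, IsLine B w ξ η → f η ξ = -f ξ η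

/-- A `1`-cochain is supported on the subtree `X`: it vanishes on lines not passing
through `X`, and depends only on the pair of components of `T ∖ X` containing the two
endpoints. -/
def SupportedOn1 {r : ℕ} (w : Fin r → FreeGroup B)
    (f : Boundary B → Boundary B → ℤ) (X : Set (FreeGroup B)) : Prop :=
  (∀ ξ η, IsLine B w ξ η → ¬PassesThrough B ξ η X → f ξ η = 0) ∧
  (∀ C C' : Set (FreeGroup B), IsComponentOf B X C → IsComponentOf B X C' → C ≠ C' →
    ∀ ξ ξ' η η', IsLine B w ξ η → IsLine B w ξ' η' →
      ξ ∈ boundaryOf B C → ξ' ∈ boundaryOf B C →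
      η ∈ boundaryOf B C' → η' ∈ boundaryOf B C' →
      f ξ η = f ξ' η')

/-- Membership in `C¹`: an antisymmetric integer-valued function on oriented lines
supported on at least one finite nonempty subtree of `T`. -/
def MemC1 {r : ℕ} (w : Fin r → FreeGroup B)
    (f : Boundary B → Boundary B → ℤ) : Prop :=
  Antisym B w f ∧
    ∃ X : Set (FreeGroup B), X.Finite ∧ X.Nonempty ∧ IsSubtree B X ∧
      SupportedOn1 B w f X

/-- The ball of radius `R` about a set `Y` of vertices of `T` (word metric). -/
def ballAbout (Y : Set (FreeGroup B)) (R : ℕ) : Set (FreeGroup B) :=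
  {g | ∃ y ∈ Y, (y⁻¹ * g).toWord.length ≤ R}

/-- The map `p : (ℤ[F])^k → C¹` of right `ℤ[F]`-modules determined by generators
`f j`, sending `e_j · g` to `f j · g`. -/
noncomputable def pC1 {k : ℕ} (f : Fin k → Boundary B → Boundary B → ℤ)
    (x : (Fin k × FreeGroup B) →₀ ℤ) : Boundary B → Boundary B → ℤ :=
  fun ξ η => x.sum fun p n => n * f p.1 (actB B p.2 ξ) (actB B p.2 η)

/-- `σ : ∂F → ℤ` is constant on `∂C` for every connected component `C` of `T ∖ X`. -/
def ConstOnComponents (X : Set (FreeGroup B)) (σ : Boundary B → ℤ) : Prop :=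
  ∀ C : Set (FreeGroup B), IsComponentOf B X C →
    ∀ ξ, ξ ∈ boundaryOf B C → ∀ η, η ∈ boundaryOf B C → σ ξ = σ η

/-- The shadow `S(g) ⊆ ∂F` of a nontrivial group element `g`: the boundary points
having the reduced word of `g` as an initial segment. -/
def shadow (g : FreeGroup B) : Set (Boundary B) :=
  {ξ | prefixOf B ξ g.toWord.length = g}

end DecompPaper

namespace DecompPaper

section Words

variable {B : Type}

theorem mk_letter_mul_mk_inv (x : B × Bool) :
    FreeGroup.mk [x] * FreeGroup.mk [(x.1, !x.2)] = 1 := by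
  have h : FreeGroup.mk [(x.1, !x.2)] = (FreeGroup.mk [x])⁻¹ := by
    simp [FreeGroup.inv_mk, FreeGroup.invRev]
  rw [h, mul_inv_cancel]

theorem letter_compat_iff {x y : B × Bool} : (x.1 = y.1 → x.2 = y.2) ↔ y ≠ (x.1, !x.2) := by
  rcases x with ⟨a, _ | _⟩ <;> rcases y with ⟨b, _ | _⟩ <;> simp [eq_comm]

theorem exists_crossing {p : ℕ → Prop} {K : ℕ} (h0 : ¬p 0) (hK : p K) :
    ∃ k, ¬p k ∧ p (k + 1) := by
  by_contra! h
  have : ∀ k, ¬p k := fun k => by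
    induction k with
    | zero => exact h0
    | succ k ih => exact h k ih
  exact this K hK

theorem ofFn_prefix_iff (ξ : ℕ → B × Bool) (m : ℕ) (L : List (B × Bool)) :
    (List.ofFn fun i : Fin m => ξ i) <+: L ↔ ∀ i < m, L[i]? = some (ξ i) := by
  rw [List.prefix_iff_getElem?]
  simp

theorem isReduced_ofFn (ξ : Boundary B) (m : ℕ) :
    FreeGroup.IsReduced (List.ofFn fun i : Fin m => ξ.1 i) := by
  refine List.isChain_ofFn.2 fun i _ => letter_compat_iff.2 (ξ.2 i)

theorem prefixOf_congr {ξ η : Boundary B} {m : ℕ} (h : ∀ i < m, ξ.1 i = η.1 i) :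
    prefixOf B ξ m = prefixOf B η m := by
  unfold prefixOf
  congr 2
  funext i
  exact h i i.2

theorem prefixOf_succ (ξ : Boundary B) (k : ℕ) :
    prefixOf B ξ (k + 1) = prefixOf B ξ k * FreeGroup.mk [ξ.1 k] := by
  unfold prefixOf
  rw [FreeGroup.mul_mk, List.ofFn_succ_last]
  rfl

theorem lineGeodesic_comm (ξ η : Boundary B) : lineGeodesic B ξ η = lineGeodesic B η ξ := by
  ext g
  simp only [lineGeodesic, Set.mem_ofPred_eq, or_comm, ne_comm]

theorem PassesThrough.symm {ξ η : Boundary B} {X : Set (FreeGroup B)}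
    (h : PassesThrough B ξ η X) : PassesThrough B η ξ X := by
  rwa [PassesThrough, lineGeodesic_comm] at h

variable [DecidableEq B]

theorem toWord_mk_of_isReduced {L : List (B × Bool)} (h : FreeGroup.IsReduced L) :
    (FreeGroup.mk L).toWord = L := by
  rw [FreeGroup.toWord_mk, h.reduce_eq]

theorem toWord_letter_mul_of_cancel (x : B × Bool) (g : FreeGroup B) (t : List (B × Bool))
    (h : g.toWord = (x.1, !x.2) :: t) : (FreeGroup.mk [x] * g).toWord = t := by
  have ht : FreeGroup.IsReduced t :=
    FreeGroup.isReduced_toWord.infix (L₂ := g.toWord) ⟨[(x.1, !x.2)], [], by simp [h]⟩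
  have hg : g = FreeGroup.mk [(x.1, !x.2)] * FreeGroup.mk t := by
    rw [← FreeGroup.mk_toWord (x := g), h, FreeGroup.mul_mk]; rfl
  rw [hg, ← mul_assoc, mk_letter_mul_mk_inv, one_mul, toWord_mk_of_isReduced ht]

theorem toWord_letter_mul_of_not_cancel (x : B × Bool) (g : FreeGroup B)
    (h : g.toWord[0]? ≠ some (x.1, !x.2)) :
    (FreeGroup.mk [x] * g).toWord = x :: g.toWord := by
  have hr : FreeGroup.IsReduced (x :: g.toWord) := by
    have hg := FreeGroup.isReduced_toWord (x := g)
    cases hL : g.toWord with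
    | nil => simp [FreeGroup.IsReduced]
    | cons y t =>
      rw [hL] at hg h
      refine List.isChain_cons_cons.2 ⟨letter_compat_iff.2 ?_, hg⟩
      simpa using h
  rw [← toWord_mk_of_isReduced hr]
  congr 1
  conv_lhs => rw [← FreeGroup.mk_toWord (x := g)]
  rw [FreeGroup.mul_mk]; rfl

/-- Right multiplication by a letter either appends that letter or deletes the last one. -/
theorem toWord_mul_letter (x : B × Bool) (g : FreeGroup B) :
    (g * FreeGroup.mk [x]).toWord = g.toWord ++ [x] ∨
      (g * FreeGroup.mk [x]).toWord ++ [(x.1, !x.2)] = g.toWord := by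
  have hg := FreeGroup.isReduced_toWord (x := g)
  by_cases hr : FreeGroup.IsReduced (g.toWord ++ [x])
  · left
    rw [← toWord_mk_of_isReduced hr]
    congr 1
    conv_lhs => rw [← FreeGroup.mk_toWord (x := g)]
    rw [FreeGroup.mul_mk]
  · right
    rcases List.eq_nil_or_concat g.toWord with h | ⟨L, y, h⟩
    · exact absurd (by simp [h, FreeGroup.IsReduced]) hr
    rw [List.concat_eq_append] at h
    have hy : y = (x.1, !x.2) := by
      by_contra hne
      apply hr
      refine List.isChain_append.2 ⟨hg, by simp, ?_⟩
      simp only [h, List.getLast?_concat, List.head?_cons, Option.mem_some_iff]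
      rintro _ rfl _ rfl
      refine letter_compat_iff.2 fun hx => hne ?_
      simp [hx]
    have hx : x = (y.1, !y.2) := by simp [hy]
    have hL : FreeGroup.IsReduced L := hg.infix ⟨[], [y], by simp [h]⟩
    have hgL : g = FreeGroup.mk L * FreeGroup.mk [y] := by
      rw [← FreeGroup.mk_toWord (x := g), h, FreeGroup.mul_mk]
    rw [← hy, h, hgL, mul_assoc, hx, mk_letter_mul_mk_inv, mul_one, toWord_mk_of_isReduced hL]

/-- A walk from `a` reaching the part of the tree beyond the vertex `P` either started there
or passed through `P`. -/
theorem prefix_or_norm_le (a : FreeGroup B) (P s : List (B × Bool))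
    (h : P <+: (a * FreeGroup.mk s).toWord) :
    P <+: a.toWord ∨ ((FreeGroup.mk P)⁻¹ * (a * FreeGroup.mk s)).norm ≤ s.length := by
  induction s using List.reverseRecOn with
  | nil => left; simpa [← FreeGroup.one_eq_mk] using h
  | append_singleton s x ih =>
    have hs : a * FreeGroup.mk (s ++ [x]) = a * FreeGroup.mk s * FreeGroup.mk [x] := by
      rw [mul_assoc, FreeGroup.mul_mk]
    have step : P <+: (a * FreeGroup.mk s).toWord → P <+: a.toWord ∨
        ((FreeGroup.mk P)⁻¹ * (a * FreeGroup.mk (s ++ [x]))).norm ≤ (s ++ [x]).length := by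
      intro hp
      refine (ih hp).imp_right fun hn => ?_
      rw [hs, ← mul_assoc]
      refine (FreeGroup.norm_mul_le _ _).trans ?_
      have := FreeGroup.norm_mk_le (L₁ := [x])
      simp only [List.length_append] at this ⊢
      omega
    rw [hs] at h
    rcases toWord_mul_letter x (a * FreeGroup.mk s) with h' | h'
    · rw [h'] at h
      rcases List.prefix_concat_iff.1 h with hP | hP
      · right
        rw [← h'] at hP
        rw [hP, FreeGroup.mk_toWord, hs, inv_mul_cancel, FreeGroup.norm_one]
        exact Nat.zero_le _
      · exact step hP
    · exact step (h.trans ⟨_, h'⟩)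

theorem norm_le_of_crossing {a b : FreeGroup B} {P : List (B × Bool)}
    (ha : ¬P <+: a.toWord) (hb : P <+: b.toWord) :
    ((FreeGroup.mk P)⁻¹ * b).norm ≤ (a⁻¹ * b).norm := by
  have h := prefix_or_norm_le a P (a⁻¹ * b).toWord
  rw [FreeGroup.mk_toWord, mul_inv_cancel_left] at h
  exact (h hb).resolve_left ha

end Words

section Limits

variable {B : Type} [DecidableEq B]

theorem toWord_prefixOf (ξ : Boundary B) (m : ℕ) :
    (prefixOf B ξ m).toWord = List.ofFn fun i : Fin m => ξ.1 i :=
  toWord_mk_of_isReduced (isReduced_ofFn ξ m)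

theorem norm_prefixOf (ξ : Boundary B) (m : ℕ) : (prefixOf B ξ m).norm = m := by
  simp [FreeGroup.norm, toWord_prefixOf]

theorem prefixOf_injective (ξ : Boundary B) : Function.Injective (prefixOf B ξ) :=
  Function.LeftInverse.injective (norm_prefixOf ξ)

theorem TendstoBoundary.unique {a : ℕ → FreeGroup B} {ξ η : Boundary B}
    (h₁ : TendstoBoundary B a ξ) (h₂ : TendstoBoundary B a η) : ξ = η := by
  refine Subtype.ext (funext fun n => ?_)
  obtain ⟨K₁, hK₁⟩ := h₁ (n + 1)
  obtain ⟨K₂, hK₂⟩ := h₂ (n + 1)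
  have e₁ := (ofFn_prefix_iff _ _ _).1 (hK₁ _ (le_max_left K₁ K₂)) n (by omega)
  have e₂ := (ofFn_prefix_iff _ _ _).1 (hK₂ _ (le_max_right K₁ K₂)) n (by omega)
  exact Option.some.inj (e₁.symm.trans e₂)

theorem TendstoBoundary.comp_succ {a : ℕ → FreeGroup B} {ξ : Boundary B}
    (h : TendstoBoundary B a ξ) : TendstoBoundary B (fun k => a (k + 1)) ξ := fun m =>
  let ⟨K, hK⟩ := h m
  ⟨K, fun k hk => hK (k + 1) (by omega)⟩

theorem TendstoBoundary.mul_right {a : ℕ → FreeGroup B} {ξ : Boundary B}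
    (h : TendstoBoundary B a ξ) (v : FreeGroup B) : TendstoBoundary B (fun k => a k * v) ξ := by
  rw [← FreeGroup.mk_toWord (x := v)]
  induction v.toWord using List.reverseRecOn with
  | nil => simpa [← FreeGroup.one_eq_mk] using h
  | append_singleton s x ih =>
    intro m
    obtain ⟨K, hK⟩ := ih (m + 1)
    refine ⟨K, fun k hk => ?_⟩
    have hk' := hK k hk
    have hs : a k * FreeGroup.mk (s ++ [x]) = a k * FreeGroup.mk s * FreeGroup.mk [x] := by
      rw [mul_assoc, FreeGroup.mul_mk]
    rw [ofFn_prefix_iff] at hk' ⊢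
    intro i hi
    simp only [hs]
    rcases toWord_mul_letter x (a k * FreeGroup.mk s) with h' | h'
    · rw [h', List.getElem?_append_left, hk' i (by omega)]
      exact (List.getElem?_eq_some_iff.1 (hk' i (by omega))).1
    · have hm := (List.getElem?_eq_some_iff.1 (hk' m (by omega))).1
      rw [← hk' i (by omega), ← h', List.getElem?_append_left]
      rw [← h', List.length_append, List.length_singleton] at hm
      omega

theorem TendstoBoundary.letter_mul {a : ℕ → FreeGroup B} {ξ : Boundary B}
    (h : TendstoBoundary B a ξ) (x : B × Bool) :
    TendstoBoundary B (fun k => FreeGroup.mk [x] * a k) (consB B x ξ) := by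
  intro m
  obtain ⟨K, hK⟩ := h (m + 1)
  refine ⟨K, fun k hk => ?_⟩
  have hk' := (ofFn_prefix_iff _ _ _).1 (hK k hk)
  rw [ofFn_prefix_iff]
  intro i hi
  have h0 := hk' 0 (by omega)
  unfold consB
  split_ifs with hc
  · obtain ⟨y, t, ht⟩ : ∃ y t, (a k).toWord = y :: t := by
      cases hw : (a k).toWord with
      | nil => simp [hw] at h0
      | cons y t => exact ⟨y, t, rfl⟩
    have hy : y = (x.1, !x.2) := by simpa [ht, hc] using h0
    rw [toWord_letter_mul_of_cancel x (a k) t (hy ▸ ht)]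
    simpa [ht] using hk' (i + 1) (by omega)
  · rw [toWord_letter_mul_of_not_cancel x (a k) (by rw [h0]; simpa using hc)]
    cases i with
    | zero => simp
    | succ i => simpa using hk' i (by omega)

/-- A sequence of group elements whose reduced words extend one another converges. -/
theorem exists_tendstoBoundary_of_prefix (a : ℕ → FreeGroup B)
    (hpre : ∀ k, (a k).toWord <+: (a (k + 1)).toWord) (hlen : ∀ k, k ≤ (a k).toWord.length) :
    ∃ ξ : Boundary B, TendstoBoundary B a ξ := by
  have hmono : ∀ k l, k ≤ l → (a k).toWord <+: (a l).toWord := fun k l hkl =>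
    Nat.le_induction (List.prefix_refl _) (fun l _ ih => ih.trans (hpre l)) l hkl
  have hlt : ∀ n, n < (a (n + 1)).toWord.length := fun n => hlen (n + 1)
  let s : ℕ → B × Bool := fun n => (a (n + 1)).toWord[n]'(hlt n)
  have hs : ∀ n k, n < k → (a k).toWord[n]? = some (s n) := fun n k hnk =>
    List.prefix_iff_getElem?.1 (hmono (n + 1) k hnk) n (hlt n)
  refine ⟨⟨s, fun n => ?_⟩, fun m => ⟨m, fun k hk => ?_⟩⟩
  · intro heq
    have h₁ := hs n (n + 2) (by omega)
    have h₂ := hs (n + 1) (n + 2) (by omega)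
    obtain ⟨hl₁, h₁⟩ := List.getElem?_eq_some_iff.1 h₁
    obtain ⟨hl₂, h₂⟩ := List.getElem?_eq_some_iff.1 h₂
    have hc := List.isChain_iff_getElem.1 (FreeGroup.isReduced_toWord (x := a (n + 2))) n hl₂
    rw [h₁, h₂, heq] at hc
    simpa using hc rfl
  · rw [ofFn_prefix_iff]
    exact fun i hi => hs i k (by omega)

theorem exists_tendstoBoundary_pow {c : FreeGroup B} (hc : c ≠ 1)
    (hcyc : FreeGroup.IsCyclicallyReduced c.toWord) :
    ∃ ξ : Boundary B, TendstoBoundary B (fun k => c ^ k) ξ ∧ c.toWord[0]? = some (ξ.1 0) := by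
  have hpow : ∀ k, (c ^ k).toWord = (List.replicate k c.toWord).flatten := fun k => by
    rw [FreeGroup.toWord_pow, (hcyc.flatten_replicate k).isReduced.reduce_eq]
  have hpos : 0 < c.toWord.length := List.length_pos_iff.2 (by simpa using hc)
  have hpre : ∀ k, (c ^ k).toWord <+: (c ^ (k + 1)).toWord := fun k => by
    rw [hpow, hpow, List.replicate_succ', List.flatten_concat]
    exact List.prefix_append _ _
  obtain ⟨ξ, hξ⟩ := exists_tendstoBoundary_of_prefix (fun k => c ^ k) hpre (fun k => by
    rw [hpow]
    simp only [List.length_flatten, List.map_replicate, List.sum_replicate, smul_eq_mul]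
    exact Nat.le_mul_of_pos_right k hpos)
  refine ⟨ξ, hξ, ?_⟩
  obtain ⟨K, hK⟩ := hξ 1
  have h := (ofFn_prefix_iff _ _ _).1 (hK (K + 1) (by omega)) 0 (by omega)
  simp only [hpow, List.replicate_succ, List.flatten_cons] at h
  rwa [List.getElem?_append_left hpos] at h

end Limits

section Action

variable {B : Type} [DecidableEq B]

theorem consB_consB_inv (x : B × Bool) (ξ : Boundary B) :
    consB B x (consB B (x.1, !x.2) ξ) = ξ := by
  by_cases h : ξ.1 0 = x
  · have h1 : consB B (x.1, !x.2) ξ = ⟨fun k => ξ.1 (k + 1), fun k => ξ.2 (k + 1)⟩ := by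
      rw [consB, dif_pos (by simpa using h)]
    rw [h1, consB, dif_neg]
    · refine Subtype.ext (funext fun k => ?_)
      cases k with
      | zero => exact h.symm
      | succ k => rfl
    · have := ξ.2 0
      rw [h] at this
      exact this
  · have h1 : ¬ξ.1 0 = ((x.1, !x.2).1, !(x.1, !x.2).2) := by simpa using h
    conv_lhs => rw [consB]
    rw [dif_pos]
    · refine Subtype.ext (funext fun k => ?_)
      simp only [consB, dif_neg h1]
    · simp only [consB, dif_neg h1]
      rfl

/-- Prepending a letter, as a permutation of the boundary. -/
def consPerm (b : B) : Equiv.Perm (Boundary B) where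
  toFun := consB B (b, true)
  invFun := consB B (b, false)
  left_inv := consB_consB_inv (b, false)
  right_inv := consB_consB_inv (b, true)

theorem lift_consPerm_mk (L : List (B × Bool)) (ξ : Boundary B) :
    FreeGroup.lift consPerm (FreeGroup.mk L) ξ = L.foldr (consB B) ξ := by
  induction L with
  | nil => simp [← FreeGroup.one_eq_mk]
  | cons x L ih =>
    rw [FreeGroup.lift_mk] at ih ⊢
    rw [List.map_cons, List.prod_cons, Equiv.Perm.mul_apply, ih, List.foldr_cons]
    rcases x with ⟨b, _ | _⟩ <;> rfl

theorem lift_consPerm (g : FreeGroup B) (ξ : Boundary B) :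
    FreeGroup.lift consPerm g ξ = actB B g ξ := by
  conv_lhs => rw [← FreeGroup.mk_toWord (x := g)]
  exact lift_consPerm_mk _ _

theorem actB_mul (g h : FreeGroup B) (ξ : Boundary B) :
    actB B (g * h) ξ = actB B g (actB B h ξ) := by
  simp only [← lift_consPerm, map_mul, Equiv.Perm.mul_apply]

theorem actB_one (ξ : Boundary B) : actB B 1 ξ = ξ := by
  simp only [← lift_consPerm, map_one, Equiv.Perm.one_apply]

theorem actB_eq_iff (g : FreeGroup B) (ξ η : Boundary B) :
    actB B g ξ = η ↔ ξ = actB B g⁻¹ η := by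
  constructor
  · rintro rfl; rw [← actB_mul, inv_mul_cancel, actB_one]
  · rintro rfl; rw [← actB_mul, mul_inv_cancel, actB_one]

theorem TendstoBoundary.actB {a : ℕ → FreeGroup B} {ξ : Boundary B}
    (h : TendstoBoundary B a ξ) (g : FreeGroup B) :
    TendstoBoundary B (fun k => g * a k) (actB B g ξ) := by
  rw [← lift_consPerm, ← FreeGroup.mk_toWord (x := g), lift_consPerm_mk]
  induction g.toWord with
  | nil => simpa [← FreeGroup.one_eq_mk] using h
  | cons x L ih =>
    have : ∀ k, FreeGroup.mk (x :: L) * a k = FreeGroup.mk [x] * (FreeGroup.mk L * a k) :=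
      fun k => by rw [← mul_assoc, FreeGroup.mul_mk]; rfl
    simp only [this, List.foldr_cons]
    exact ih.letter_mul x

/-- Nontrivial elements have an attracting and a repelling boundary point, and these differ. -/
theorem exists_endpoints {w : FreeGroup B} (hw : w ≠ 1) :
    ∃ ξ η : Boundary B, ξ ≠ η ∧ TendstoBoundary B (fun k => w ^ k) ξ ∧
      TendstoBoundary B (fun k => w⁻¹ ^ k) η := by
  let L := FreeGroup.reduceCyclically w.toWord
  have hL : FreeGroup.IsCyclicallyReduced L :=
    FreeGroup.reduceCyclically.isCyclicallyReduced FreeGroup.isReduced_toWord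
  let u := FreeGroup.mk (FreeGroup.reduceCyclically.conjugator w.toWord)
  let c := FreeGroup.mk L
  have hcL : c.toWord = L := toWord_mk_of_isReduced hL.isReduced
  have hwc : w = u * c * u⁻¹ := by
    conv_lhs => rw [← FreeGroup.mk_toWord (x := w),
      ← FreeGroup.reduceCyclically.conj_conjugator_reduceCyclically w.toWord]
    simp only [u, c, FreeGroup.inv_mk, FreeGroup.mul_mk, L]
  have hc : c ≠ 1 := by
    intro h
    rw [h] at hwc
    exact hw (by simpa using hwc)
  have hci : FreeGroup.IsCyclicallyReduced c⁻¹.toWord := by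
    refine ⟨FreeGroup.isReduced_toWord, ?_⟩
    rw [FreeGroup.toWord_inv, hcL]
    intro a ha b hb hab
    have h1 := hL.2
    simp only [FreeGroup.invRev, List.getLast?_reverse, List.head?_reverse, List.head?_map,
      List.getLast?_map, Option.mem_def, Option.map_eq_some_iff] at ha hb
    obtain ⟨a', ha', rfl⟩ := ha
    obtain ⟨b', hb', rfl⟩ := hb
    simpa using (h1 b' hb' a' ha' hab.symm).symm
  obtain ⟨ξ, hξ, hξ0⟩ := exists_tendstoBoundary_pow hc (hcL ▸ hL)
  obtain ⟨η, hη, hη0⟩ := exists_tendstoBoundary_pow (inv_ne_one.2 hc) hci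
  refine ⟨actB B u ξ, actB B u η, ?_, ?_, ?_⟩
  · intro h
    rw [actB_eq_iff, ← actB_mul, inv_mul_cancel, actB_one] at h
    subst h
    rw [FreeGroup.toWord_inv, FreeGroup.invRev, ← List.head?_eq_getElem?, List.head?_reverse,
      List.getLast?_map, Option.map_eq_some_iff] at hη0
    rw [← List.head?_eq_getElem?] at hξ0
    obtain ⟨a, ha, ha'⟩ := hη0
    rw [hcL] at ha hξ0
    have := hL.2 a ha _ hξ0
    grind
  · have := (hξ.actB u).mul_right u⁻¹
    simpa only [hwc, conj_pow] using this
  · have := (hη.actB u).mul_right u⁻¹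
    have h2 : w⁻¹ = u * c⁻¹ * u⁻¹ := by rw [hwc]; group
    simpa only [h2, conj_pow] using this

end Action

end DecompPaper
namespace DecompPaper

section Geometry

variable {B : Type} [DecidableEq B]

theorem finite_norm_le [Finite B] (D : ℕ) : {g : FreeGroup B | g.norm ≤ D}.Finite :=
  (List.finite_length_le (B × Bool) D).preimage FreeGroup.toWord_injective.injOn

/-- The powers converging to a boundary point stay close to the ray towards it. -/
theorem TendstoBoundary.exists_norm_le {a g : FreeGroup B} {ξ : Boundary B}
    (h : TendstoBoundary B (fun k => g * a ^ k) ξ) :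
    ∃ D, ∀ t, ∃ k : ℕ, ((prefixOf B ξ t)⁻¹ * (g * a ^ k)).norm ≤ D := by
  refine ⟨a.norm + 2 * g.norm, fun t => ?_⟩
  by_cases h0 : (List.ofFn fun i : Fin t => ξ.1 i) <+: g.toWord
  · refine ⟨0, ?_⟩
    have hle := h0.length_le
    rw [List.length_ofFn] at hle
    have := FreeGroup.norm_mul_le (prefixOf B ξ t)⁻¹ g
    rw [FreeGroup.norm_inv_eq, norm_prefixOf] at this
    rw [pow_zero, mul_one]
    change t ≤ g.norm at hle
    omega
  · obtain ⟨K, hK⟩ := h t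
    obtain ⟨k, hk, hk'⟩ := exists_crossing
      (p := fun k => (List.ofFn fun i : Fin t => ξ.1 i) <+: (g * a ^ k).toWord)
      (by simpa using h0) (hK K le_rfl)
    refine ⟨k + 1, (norm_le_of_crossing hk hk').trans ?_⟩
    have : (g * a ^ k)⁻¹ * (g * a ^ (k + 1)) = a := by rw [pow_succ]; group
    rw [this]
    omega

/-- Two elements sharing a limit point at infinity have a common nontrivial power. -/
theorem exists_commensurable [Finite B] {a b g : FreeGroup B} {ξ : Boundary B}
    (ha : TendstoBoundary B (fun k => g * a ^ k) ξ) (hb : TendstoBoundary B (fun k => b ^ k) ξ) :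
    ∃ x ∈ Subgroup.zpowers a, x ≠ 1 ∧ g * x * g⁻¹ ∈ Subgroup.zpowers b := by
  obtain ⟨D, hD⟩ := ha.exists_norm_le
  obtain ⟨E, hE⟩ := TendstoBoundary.exists_norm_le (g := 1) (a := b) (by simpa using hb)
  choose k hk using hD
  choose m hm using hE
  obtain ⟨s, -, t, -, hst, heq⟩ := Set.infinite_univ.exists_ne_map_eq_of_mapsTo
    (f := fun t => ((prefixOf B ξ t)⁻¹ * (g * a ^ k t), (prefixOf B ξ t)⁻¹ * (1 * b ^ m t)))
    (t := {g : FreeGroup B | g.norm ≤ D} ×ˢ {g : FreeGroup B | g.norm ≤ E}) (fun t _ => ⟨hk t, hm t⟩)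
    ((finite_norm_le D).prod (finite_norm_le E))
  obtain ⟨h₁, h₂⟩ := Prod.mk.inj heq
  have hne : prefixOf B ξ s * (prefixOf B ξ t)⁻¹ ≠ 1 := fun h =>
    hst (prefixOf_injective ξ (mul_inv_eq_one.1 h))
  have e₁ : g * (a ^ k s * (a ^ k t)⁻¹) * g⁻¹ = prefixOf B ξ s * (prefixOf B ξ t)⁻¹ := by
    rw [inv_mul_eq_iff_eq_mul] at h₁
    calc _ = g * a ^ k s * (g * a ^ k t)⁻¹ := by group
      _ = _ := by rw [h₁]; group
  have e₂ : b ^ m s * (b ^ m t)⁻¹ = prefixOf B ξ s * (prefixOf B ξ t)⁻¹ := by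
    rw [inv_mul_eq_iff_eq_mul, one_mul, one_mul] at h₂
    rw [h₂]; group
  have hz : ∀ (c : FreeGroup B) (i j : ℕ), c ^ i * (c ^ j)⁻¹ ∈ Subgroup.zpowers c := fun c i j =>
    mul_mem (Subgroup.npow_mem_zpowers c i) (inv_mem (Subgroup.npow_mem_zpowers c j))
  refine ⟨_, hz a (k s) (k t), fun h => hne ?_, ?_⟩
  · rw [← e₁, h]; group
  · rw [e₁, ← e₂]; exact hz b _ _

theorem exists_norm_le_of_prefixOf {a g : FreeGroup B} {ξ η : Boundary B}
    (hξ : TendstoBoundary B (fun k => g * a ^ k) ξ)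
    (hη : TendstoBoundary B (fun k => g * a⁻¹ ^ k) η) {k : ℕ} (hk : ∃ i ≤ k, ξ.1 i ≠ η.1 i) :
    ∃ z : ℤ, ((prefixOf B ξ k)⁻¹ * (g * a ^ z)).norm ≤ a.norm + 1 := by
  obtain ⟨i, hik, hi⟩ := hk
  obtain ⟨K, hK⟩ := hξ (k + 1)
  obtain ⟨N, hN⟩ := hη (k + 1)
  obtain ⟨n, hn, hn'⟩ := exists_crossing (K := N + K)
    (p := fun n : ℕ => (List.ofFn fun i : Fin (k + 1) => ξ.1 i) <+:
      (g * a ^ ((n : ℤ) - N)).toWord)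
    (by
      intro h
      have h' := hN N le_rfl
      rw [ofFn_prefix_iff] at h h'
      have h₁ := h i (by omega)
      have h₂ := h' i (by omega)
      rw [show a ^ (((0 : ℕ) : ℤ) - N) = a⁻¹ ^ N by simp] at h₁
      exact hi (Option.some.inj (h₁.symm.trans h₂)))
    (by
      have := hK K le_rfl
      rwa [show ((N + K : ℕ) : ℤ) - N = K by push_cast; ring, zpow_natCast])
  refine ⟨((n + 1 : ℕ) : ℤ) - N, ?_⟩
  have h₁ := norm_le_of_crossing hn hn'
  have h₂ : (g * a ^ ((n : ℤ) - N))⁻¹ * (g * a ^ (((n + 1 : ℕ) : ℤ) - N)) = a := by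
    rw [show ((n + 1 : ℕ) : ℤ) - N = ((n : ℤ) - N) + 1 by push_cast; ring, zpow_add_one]
    group
  rw [h₂] at h₁
  have h₃ : (prefixOf B ξ k)⁻¹ * (g * a ^ (((n + 1 : ℕ) : ℤ) - N)) = FreeGroup.mk [ξ.1 k] *
      ((prefixOf B ξ (k + 1))⁻¹ * (g * a ^ (((n + 1 : ℕ) : ℤ) - N))) := by
    rw [prefixOf_succ]; group
  rw [h₃]
  refine (FreeGroup.norm_mul_le _ _).trans ?_
  have := FreeGroup.norm_mk_le (L₁ := [ξ.1 k])
  rw [List.length_singleton] at this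
  change ((prefixOf B ξ (k + 1))⁻¹ * (g * a ^ (((n + 1 : ℕ) : ℤ) - N))).norm ≤ _ at h₁
  omega

/-- The coset `g⟨a⟩` comes close to every vertex of the corresponding line. -/
theorem exists_norm_le_of_mem_lineGeodesic {a g v : FreeGroup B} {ξ η : Boundary B}
    (hξ : TendstoBoundary B (fun k => g * a ^ k) ξ)
    (hη : TendstoBoundary B (fun k => g * a⁻¹ ^ k) η) (hv : v ∈ lineGeodesic B ξ η) :
    ∃ z : ℤ, (v⁻¹ * (g * a ^ z)).norm ≤ a.norm + 1 := by
  obtain ⟨k, rfl | rfl, i, hik, hi⟩ := hv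
  · exact exists_norm_le_of_prefixOf hξ hη ⟨i, hik, hi⟩
  · obtain ⟨z, hz⟩ := exists_norm_le_of_prefixOf (a := a⁻¹) hη (by simpa using hξ)
      ⟨i, hik, hi.symm⟩
    exact ⟨-z, by simpa using hz⟩

theorem isSubtree_norm_le (R : ℕ) : IsSubtree B {g : FreeGroup B | g.norm ≤ R} := by
  have hmem : ∀ L : List (B × Bool), L.length ≤ R → (FreeGroup.mk L).norm ≤ R := fun L hL =>
    FreeGroup.norm_mk_le.trans hL
  have hsnoc : ∀ (L : List (B × Bool)) x,
      FreeGroup.mk (L ++ [x]) = FreeGroup.mk L * FreeGroup.mk [x] := fun L x => by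
    rw [FreeGroup.mul_mk]
  have out : ∀ L : List (B × Bool), L.length ≤ R → Relation.ReflTransGen
      (fun a b => Adj B a b ∧ b ∈ {g : FreeGroup B | g.norm ≤ R}) 1 (FreeGroup.mk L) := by
    intro L hL
    induction L using List.reverseRecOn with
    | nil => exact .refl
    | append_singleton L x ih =>
      refine .tail (ih ?_) ⟨⟨x, hsnoc L x⟩, hmem _ hL⟩
      simp only [List.length_append] at hL
      omega
  have back : ∀ L : List (B × Bool), L.length ≤ R → Relation.ReflTransGen
      (fun a b => Adj B a b ∧ b ∈ {g : FreeGroup B | g.norm ≤ R}) (FreeGroup.mk L) 1 := by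
    intro L hL
    induction L using List.reverseRecOn with
    | nil => exact .refl
    | append_singleton L x ih =>
      have hL' : L.length ≤ R := by
        simp only [List.length_append] at hL
        omega
      refine .head ⟨⟨(x.1, !x.2), ?_⟩, hmem L hL'⟩ (ih hL')
      rw [hsnoc, mul_assoc, mk_letter_mul_mk_inv, mul_one]
  intro g hg h hh
  have h₁ := back g.toWord hg
  have h₂ := out h.toWord hh
  rw [FreeGroup.mk_toWord] at h₁ h₂
  exact h₁.trans h₂

/-- Boundary points of one component of the complement of a ball share a long prefix. -/
theorem eq_of_mem_boundaryOf {R : ℕ} {C : Set (FreeGroup B)}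
    (hC : IsComponentOf B {g : FreeGroup B | g.norm ≤ R} C) {ξ ξ' : Boundary B}
    (hξ : ξ ∈ boundaryOf B C) (hξ' : ξ' ∈ boundaryOf B C) {i : ℕ} (hi : i ≤ R) :
    ξ.1 i = ξ'.1 i := by
  obtain ⟨v, -, rfl⟩ := hC
  have key : ∀ u, Relation.ReflTransGen (fun a b => Adj B a b ∧
      a ∉ {g : FreeGroup B | g.norm ≤ R} ∧ b ∉ {g : FreeGroup B | g.norm ≤ R}) v u →
      u.toWord[i]? = v.toWord[i]? := by
    intro u hu
    induction hu with
    | refl => rfl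
    | @tail a b _ hab ih =>
      obtain ⟨⟨x, rfl⟩, ha, hb⟩ := hab
      rw [← ih]
      simp only [Set.mem_ofPred_eq, not_le, FreeGroup.norm] at ha hb
      rcases toWord_mul_letter x a with h | h
      · rw [h, List.getElem?_append_left (by omega)]
      · rw [← h, List.getElem?_append_left (by omega)]
  obtain ⟨m, hm⟩ := hξ
  obtain ⟨m', hm'⟩ := hξ'
  have h₁ := key _ (hm (m + m' + (R + 1)) (by omega))
  have h₂ := key _ (hm' (m + m' + (R + 1)) (by omega))
  have get : ∀ ζ : Boundary B, (prefixOf B ζ (m + m' + (R + 1))).toWord[i]? = some (ζ.1 i) :=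
    fun ζ => by
      rw [toWord_prefixOf]
      exact (ofFn_prefix_iff ζ.1 _ _).1 (List.prefix_refl _) i (by omega)
  rw [get] at h₁ h₂
  exact Option.some.inj (h₁.trans h₂.symm)

end Geometry

end DecompPaper
namespace DecompPaper

section Lines

variable {B : Type} [DecidableEq B] {r : ℕ} {w : Fin r → FreeGroup B} {P M : Fin r → Boundary B}

theorem IsLine.symm {ξ η : Boundary B} (h : IsLine B w ξ η) : IsLine B w η ξ :=
  let ⟨g, i, h⟩ := h
  ⟨g, i, h.symm⟩

/-- The endpoints of the line represented by the basis element `e_i · g` of the free module. -/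
def endpoints (P M : Fin r → Boundary B) (p : Fin r × FreeGroup B) : Boundary B × Boundary B :=
  (actB B p.2⁻¹ (P p.1), actB B p.2⁻¹ (M p.1))

theorem isLine_iff (hP : ∀ i, TendstoBoundary B (fun k => w i ^ k) (P i))
    (hM : ∀ i, TendstoBoundary B (fun k => (w i)⁻¹ ^ k) (M i)) {ξ η : Boundary B} :
    IsLine B w ξ η ↔ ∃ p, endpoints P M p = (ξ, η) ∨ endpoints P M p = (η, ξ) := by
  constructor
  · rintro ⟨g, i, ⟨h₁, h₂⟩ | ⟨h₁, h₂⟩⟩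
    · refine ⟨(i, g⁻¹), .inl (Prod.ext ?_ ?_)⟩
      · simpa [endpoints] using ((hP i).actB g).unique h₁
      · simpa [endpoints] using ((hM i).actB g).unique h₂
    · refine ⟨(i, g⁻¹), .inr (Prod.ext ?_ ?_)⟩
      · simpa [endpoints] using ((hP i).actB g).unique h₁
      · simpa [endpoints] using ((hM i).actB g).unique h₂
  · rintro ⟨⟨i, g⟩, h | h⟩ <;> obtain ⟨rfl, rfl⟩ := Prod.mk.inj h
    · exact ⟨g⁻¹, i, .inl ⟨(hP i).actB g⁻¹, (hM i).actB g⁻¹⟩⟩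
    · exact ⟨g⁻¹, i, .inr ⟨(hP i).actB g⁻¹, (hM i).actB g⁻¹⟩⟩

theorem actB_zpow_eq_self {a : FreeGroup B} {ξ : Boundary B}
    (h : TendstoBoundary B (fun k => a ^ k) ξ) (z : ℤ) : actB B (a ^ z) ξ = ξ := by
  have h₁ : actB B a ξ = ξ := (h.actB a).unique (by simpa only [pow_succ'] using h.comp_succ)
  rw [← lift_consPerm] at h₁
  rw [← lift_consPerm, map_zpow]
  exact Equiv.Perm.zpow_apply_eq_self_of_apply_eq_self h₁ z

theorem actB_zpow_inv_eq_self {a : FreeGroup B} {ξ : Boundary B}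
    (h : TendstoBoundary B (fun k => a⁻¹ ^ k) ξ) (z : ℤ) : actB B (a ^ z) ξ = ξ := by
  simpa using actB_zpow_eq_self h (-z)

theorem endpoints_zpow_mul (hP : ∀ i, TendstoBoundary B (fun k => w i ^ k) (P i))
    (hM : ∀ i, TendstoBoundary B (fun k => (w i)⁻¹ ^ k) (M i)) (i : Fin r) (z : ℤ)
    (g : FreeGroup B) : endpoints P M (i, w i ^ z * g) = endpoints P M (i, g) := by
  simp only [endpoints, mul_inv_rev, actB_mul, ← zpow_neg, actB_zpow_eq_self (hP i),
    actB_zpow_inv_eq_self (hM i)]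

theorem finite_endpoints_passesThrough [Finite B]
    (hP : ∀ i, TendstoBoundary B (fun k => w i ^ k) (P i))
    (hM : ∀ i, TendstoBoundary B (fun k => (w i)⁻¹ ^ k) (M i)) {X : Set (FreeGroup B)}
    (hX : X.Finite) :
    {q | q ∈ Set.range (endpoints P M) ∧ PassesThrough B q.1 q.2 X}.Finite := by
  have hfin : (⋃ i : Fin r, ⋃ v ∈ X, (fun u => endpoints P M (i, (v * u)⁻¹)) ''
      {u : FreeGroup B | u.norm ≤ (w i).norm + 1}).Finite :=
    Set.finite_iUnion fun i => hX.biUnion fun v _ => (finite_norm_le _).image _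
  refine hfin.subset ?_
  rintro _ ⟨⟨⟨i, g⟩, rfl⟩, v, hvX, hv⟩
  obtain ⟨z, hz⟩ := exists_norm_le_of_mem_lineGeodesic ((hP i).actB g⁻¹) ((hM i).actB g⁻¹) hv
  simp only [Set.mem_iUnion]
  refine ⟨i, v, hvX, v⁻¹ * (g⁻¹ * w i ^ z), hz, ?_⟩
  have : (v * (v⁻¹ * (g⁻¹ * w i ^ z)))⁻¹ = w i ^ (-z) * g := by rw [zpow_neg]; group
  simp only [this, endpoints_zpow_mul hP hM]

theorem eq_and_mem_zpowers_of_actB_eq [Finite B] (hmal : Malnormal B w)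
    (hP : ∀ i, TendstoBoundary B (fun k => w i ^ k) (P i)) {i j : Fin r} {g : FreeGroup B}
    (h : actB B g (P i) = P j) : i = j ∧ g ∈ Subgroup.zpowers (w i) :=
  hmal g i j (exists_commensurable (h ▸ (hP i).actB g) (hP j))

theorem actB_ne [Finite B] (hmal : Malnormal B w) (hne : ∀ i, P i ≠ M i)
    (hP : ∀ i, TendstoBoundary B (fun k => w i ^ k) (P i))
    (hM : ∀ i, TendstoBoundary B (fun k => (w i)⁻¹ ^ k) (M i)) {i j : Fin r} {g : FreeGroup B} :
    actB B g (P i) ≠ M j := by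
  intro h
  obtain ⟨x, hx, hx1, hxj⟩ := exists_commensurable (h ▸ (hP i).actB g) (hM j)
  rw [Subgroup.zpowers_inv] at hxj
  obtain ⟨rfl, z, rfl⟩ := hmal g i j ⟨x, hx, hx1, hxj⟩
  exact hne i ((actB_zpow_eq_self (hP i) z).symm.trans h)

theorem exists_zpow_of_endpoints_eq [Finite B] (hmal : Malnormal B w)
    (hP : ∀ i, TendstoBoundary B (fun k => w i ^ k) (P i)) {i j : Fin r} {g h : FreeGroup B}
    (heq : endpoints P M (i, g) = endpoints P M (j, h)) : i = j ∧ ∃ z : ℤ, g = w i ^ z * h := by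
  have h₁ : actB B g⁻¹ (P i) = actB B h⁻¹ (P j) := congrArg Prod.fst heq
  have h₂ : actB B (h * g⁻¹) (P i) = P j := by
    rw [actB_mul, h₁, ← actB_mul, mul_inv_cancel, actB_one]
  obtain ⟨hij, z, hz⟩ := eq_and_mem_zpowers_of_actB_eq hmal hP h₂
  refine ⟨hij, -z, ?_⟩
  dsimp only at hz
  rw [zpow_neg, hz]
  group

theorem endpoints_ne_swap [Finite B] (hmal : Malnormal B w) (hne : ∀ i, P i ≠ M i)
    (hP : ∀ i, TendstoBoundary B (fun k => w i ^ k) (P i))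
    (hM : ∀ i, TendstoBoundary B (fun k => (w i)⁻¹ ^ k) (M i)) (p q : Fin r × FreeGroup B) :
    endpoints P M p ≠ (endpoints P M q).swap := by
  intro h
  have h₁ : actB B p.2⁻¹ (P p.1) = actB B q.2⁻¹ (M q.1) := congrArg Prod.fst h
  refine actB_ne hmal hne hP hM (g := q.2 * p.2⁻¹) (i := p.1) (j := q.1) ?_
  rw [actB_mul, h₁, ← actB_mul, mul_inv_cancel, actB_one]

end Lines

section Generators

variable {B : Type} [DecidableEq B] {r : ℕ} {w : Fin r → FreeGroup B} {P M : Fin r → Boundary B}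

open Classical in
/-- The signed indicator function of the line with endpoints `P i` and `M i`. -/
noncomputable def lineIndicator (P M : Fin r → Boundary B) (i : Fin r) (ξ η : Boundary B) : ℤ :=
  (if (P i, M i) = (ξ, η) then 1 else 0) - (if (P i, M i) = (η, ξ) then 1 else 0)

open Classical in
theorem lineIndicator_actB (i : Fin r) (g : FreeGroup B) (ξ η : Boundary B) :
    lineIndicator P M i (actB B g ξ) (actB B g η) =
      (if endpoints P M (i, g) = (ξ, η) then 1 else 0) -
        (if endpoints P M (i, g) = (η, ξ) then 1 else 0) := by
  have h : ∀ ξ η, (P i, M i) = (actB B g ξ, actB B g η) ↔ endpoints P M (i, g) = (ξ, η) := by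
    intro ξ η
    simp only [endpoints, Prod.mk.injEq, actB_eq_iff, inv_inv]
  simp only [lineIndicator, h]

/-- The map `p` is the antisymmetrization of the pushforward to pairs of endpoints. -/
theorem pC1_lineIndicator (x : (Fin r × FreeGroup B) →₀ ℤ) (ξ η : Boundary B) :
    pC1 B (lineIndicator P M) x ξ η =
      x.mapDomain (endpoints P M) (ξ, η) - x.mapDomain (endpoints P M) (η, ξ) := by
  classical
  simp only [pC1, Finsupp.mapDomain, Finsupp.sum, Finsupp.finsetSum_apply, Finsupp.single_apply,
    lineIndicator_actB, ← Finset.sum_sub_distrib]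
  exact Finset.sum_congr rfl fun p _ => by split_ifs <;> simp

theorem memC1_lineIndicator [Finite B] (hne : ∀ i, P i ≠ M i)
    (hP : ∀ i, TendstoBoundary B (fun k => w i ^ k) (P i))
    (hM : ∀ i, TendstoBoundary B (fun k => (w i)⁻¹ ^ k) (M i)) (i : Fin r) :
    MemC1 B w (lineIndicator P M i) := by
  classical
  obtain ⟨n, hn⟩ : ∃ n, (P i).1 n ≠ (M i).1 n := by
    by_contra! h
    exact hne i (Subtype.ext (funext h))
  have hpass : ∀ ξ η : Boundary B, (∀ k ≤ n, (P i).1 k = ξ.1 k) → (∀ k ≤ n, (M i).1 k = η.1 k) →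
      prefixOf B (P i) n ∈ lineGeodesic B ξ η := fun ξ η hξ hη =>
    ⟨n, .inl (prefixOf_congr fun k hk => hξ k hk.le), n, le_rfl, by
      rwa [← hξ n le_rfl, ← hη n le_rfl]⟩
  -- the finitely many lines through a vertex are told apart by prefixes of bounded length
  have hfin : {q : Boundary B × Boundary B | IsLine B w q.1 q.2 ∧
      PassesThrough B q.1 q.2 {prefixOf B (P i) n}}.Finite := by
    have h := finite_endpoints_passesThrough hP hM (Set.finite_singleton (prefixOf B (P i) n))
    refine (h.union (h.image Prod.swap)).subset ?_
    rintro ⟨ξ, η⟩ ⟨hl, hp⟩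
    obtain ⟨p, h | h⟩ := (isLine_iff hP hM).1 hl
    · exact .inl ⟨⟨p, h⟩, hp⟩
    · exact .inr ⟨(η, ξ), ⟨⟨p, h⟩, hp.symm⟩, rfl⟩
  have hsep : ∀ q : Boundary B × Boundary B, ∃ R, (∀ k ≤ R, (P i).1 k = q.1.1 k) →
      (∀ k ≤ R, (M i).1 k = q.2.1 k) → (P i, M i) = q := by
    intro q
    by_contra! h
    obtain ⟨-, -, hq⟩ := h 0
    refine hq (Prod.ext (Subtype.ext (funext fun k => ?_)) (Subtype.ext (funext fun k => ?_)))
    · exact (h k).1 k le_rfl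
    · exact (h k).2.1 k le_rfl
  choose S hS using hsep
  obtain ⟨R₀, hR₀⟩ := (hfin.image S).bddAbove
  let R := max n R₀
  have hdet : ∀ ξ η, IsLine B w ξ η → (∀ k ≤ R, (P i).1 k = ξ.1 k) →
      (∀ k ≤ R, (M i).1 k = η.1 k) → (P i, M i) = (ξ, η) := by
    intro ξ η hl hξ hη
    have hq := hpass ξ η (fun k hk => hξ k (hk.trans (le_max_left _ _)))
      (fun k hk => hη k (hk.trans (le_max_left _ _)))
    have hle : S (ξ, η) ≤ R :=
      (hR₀ ⟨(ξ, η), ⟨hl, _, rfl, hq⟩, rfl⟩).trans (le_max_right _ _)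
    exact hS (ξ, η) (fun k hk => hξ k (hk.trans hle)) (fun k hk => hη k (hk.trans hle))
  refine ⟨fun ξ η _ => by simp only [lineIndicator]; ring, {g | g.norm ≤ R}, finite_norm_le R,
    ⟨1, by simp⟩, isSubtree_norm_le R, ?_, ?_⟩
  · intro ξ η _ hnot
    have hball : prefixOf B (P i) n ∈ {g : FreeGroup B | g.norm ≤ R} := by
      rw [Set.mem_ofPred_eq, norm_prefixOf]
      exact le_max_left _ _
    have key := hpass (P i) (M i) (fun _ _ => rfl) (fun _ _ => rfl)
    have h₁ : (P i, M i) ≠ (ξ, η) := by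
      rintro h
      obtain ⟨rfl, rfl⟩ := Prod.mk.inj h
      exact hnot ⟨_, hball, key⟩
    have h₂ : (P i, M i) ≠ (η, ξ) := by
      rintro h
      obtain ⟨rfl, rfl⟩ := Prod.mk.inj h
      exact hnot (PassesThrough.symm ⟨_, hball, key⟩)
    simp [lineIndicator, h₁, h₂]
  · intro C C' hC hC' _ ξ ξ' η η' hl hl' hξ hξ' hη hη'
    have imp : ∀ {C C'} {ξ ξ' η η' : Boundary B},
        IsComponentOf B {g : FreeGroup B | g.norm ≤ R} C →
        IsComponentOf B {g : FreeGroup B | g.norm ≤ R} C' → IsLine B w ξ' η' →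
        ξ ∈ boundaryOf B C → ξ' ∈ boundaryOf B C → η ∈ boundaryOf B C' → η' ∈ boundaryOf B C' →
        (P i, M i) = (ξ, η) → (P i, M i) = (ξ', η') := by
      intro C C' ξ ξ' η η' hC hC' hl' hξ hξ' hη hη' h
      obtain ⟨rfl, rfl⟩ := Prod.mk.inj h
      exact hdet _ _ hl' (fun k hk => eq_of_mem_boundaryOf hC hξ hξ' hk)
        (fun k hk => eq_of_mem_boundaryOf hC' hη hη' hk)
    have h₁ : (P i, M i) = (ξ, η) ↔ (P i, M i) = (ξ', η') :=
      ⟨imp hC hC' hl' hξ hξ' hη hη', imp hC hC' hl hξ' hξ hη' hη⟩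
    have h₂ : (P i, M i) = (η, ξ) ↔ (P i, M i) = (η', ξ') :=
      ⟨imp hC' hC hl'.symm hη hη' hξ hξ', imp hC' hC hl.symm hη' hη hξ' hξ⟩
    simp only [lineIndicator, h₁, h₂]

theorem exists_pC1_eq [Finite B] (hmal : Malnormal B w) (hne : ∀ i, P i ≠ M i)
    (hP : ∀ i, TendstoBoundary B (fun k => w i ^ k) (P i))
    (hM : ∀ i, TendstoBoundary B (fun k => (w i)⁻¹ ^ k) (M i))
    {f : Boundary B → Boundary B → ℤ} (hf : MemC1 B w f) :
    ∃ x : (Fin r × FreeGroup B) →₀ ℤ,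
      ∀ ξ η, IsLine B w ξ η → f ξ η = pC1 B (lineIndicator P M) x ξ η := by
  classical
  obtain ⟨hanti, X, hX, -, -, hsupp, -⟩ := hf
  have hQ := finite_endpoints_passesThrough hP hM hX
  let φ : (Boundary B × Boundary B) →₀ ℤ :=
    Finsupp.onFinset hQ.toFinset (fun q => if q ∈ hQ.toFinset then f q.1 q.2 else 0)
      fun q hq => by_contra fun h => hq (if_neg h)
  have hφ : ∀ ξ η, φ (ξ, η) = if (ξ, η) ∈ Set.range (endpoints P M) ∧ PassesThrough B ξ η X
      then f ξ η else 0 := fun ξ η => by simp [φ]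
  have hrange : (φ.support : Set (Boundary B × Boundary B)) ⊆ Set.range (endpoints P M) := by
    rintro ⟨ξ, η⟩ hq
    by_contra h
    exact Finsupp.mem_support_iff.1 hq (by rw [hφ, if_neg fun h' => h h'.1])
  obtain ⟨x, hx⟩ : ∃ x : (Fin r × FreeGroup B) →₀ ℤ, x.mapDomain (endpoints P M) = φ := by
    refine ⟨(φ.comapDomain Subtype.val Subtype.val_injective.injOn).mapDomain
      (Set.rangeSplitting (endpoints P M)), ?_⟩
    rw [← Finsupp.mapDomain_comp, Set.comp_rangeSplitting,
      Finsupp.mapDomain_comapDomain _ Subtype.val_injective _ (by rwa [Subtype.range_coe])]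
  refine ⟨x, fun ξ η hl => ?_⟩
  rw [pC1_lineIndicator, hx, hφ, hφ]
  by_cases hpass : PassesThrough B ξ η X
  · obtain ⟨p, h | h⟩ := (isLine_iff hP hM).1 hl
    · have hswap : (η, ξ) ∉ Set.range (endpoints P M) := by
        rintro ⟨q, hq⟩
        exact endpoints_ne_swap hmal hne hP hM q p (by rw [hq, h, Prod.swap_prod_mk])
      rw [if_pos ⟨⟨p, h⟩, hpass⟩, if_neg fun h' => hswap h'.1, sub_zero]
    · have hswap : (ξ, η) ∉ Set.range (endpoints P M) := by
        rintro ⟨q, hq⟩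
        exact endpoints_ne_swap hmal hne hP hM q p (by rw [hq, h, Prod.swap_prod_mk])
      rw [if_neg fun h' => hswap h'.1, if_pos ⟨⟨p, h⟩, hpass.symm⟩, hanti ξ η hl]
      ring
  · rw [if_neg fun h => hpass h.2, if_neg fun h => hpass h.2.symm, hsupp ξ η hl hpass, sub_zero]

end Generators

section Relations

variable {B : Type} {r : ℕ} {w : Fin r → FreeGroup B} {P M : Fin r → Boundary B}

/-- The relation `e_i · w_i - e_i`. -/
noncomputable def lineRelation (w : Fin r → FreeGroup B) (i : Fin r) :
    (Fin r × FreeGroup B) →₀ ℤ :=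
  Finsupp.single (i, w i) 1 - Finsupp.single (i, 1) 1

theorem fsTranslate_lineRelation (i : Fin r) (g : FreeGroup B) :
    fsTranslate B (lineRelation w i) g =
      Finsupp.single (i, w i * g) 1 - Finsupp.single (i, g) 1 := by
  simp [fsTranslate, lineRelation, sub_eq_add_neg, Finsupp.mapDomain_add,
    ← Finsupp.single_neg, Finsupp.mapDomain_single]

theorem pC1_lineRelation [DecidableEq B] (hP : ∀ i, TendstoBoundary B (fun k => w i ^ k) (P i))
    (hM : ∀ i, TendstoBoundary B (fun k => (w i)⁻¹ ^ k) (M i)) (i : Fin r) (ξ η : Boundary B) :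
    pC1 B (lineIndicator P M) (lineRelation w i) ξ η = 0 := by
  have h : endpoints P M (i, w i) = endpoints P M (i, 1) := by
    simpa using endpoints_zpow_mul hP hM i 1 1
  have h0 : (lineRelation w i).mapDomain (endpoints P M) = 0 := by
    simp [lineRelation, sub_eq_add_neg, Finsupp.mapDomain_add, ← Finsupp.single_neg,
      Finsupp.mapDomain_single, h, ← Finsupp.single_add]
  simp [pC1_lineIndicator, h0]

/-- The `ℤ[F]`-submodule generated by the relations. -/
noncomputable def relationSpan (w : Fin r → FreeGroup B) :
    Submodule ℤ ((Fin r × FreeGroup B) →₀ ℤ) :=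
  Submodule.span ℤ (Set.range fun p : Fin r × FreeGroup B => fsTranslate B (lineRelation w p.1) p.2)

theorem single_sub_single_mem_relationSpan (i : Fin r) (g : FreeGroup B) (z : ℤ) :
    (Finsupp.single (i, w i ^ z * g) 1 - Finsupp.single (i, g) 1 : (Fin r × FreeGroup B) →₀ ℤ) ∈
      relationSpan w := by
  have hstep : ∀ h, (Finsupp.single (i, w i * h) 1 - Finsupp.single (i, h) 1 :
      (Fin r × FreeGroup B) →₀ ℤ) ∈ relationSpan w := fun h => by
    rw [← fsTranslate_lineRelation]
    exact Submodule.subset_span ⟨(i, h), rfl⟩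
  induction z with
  | zero => simp
  | succ n ih =>
    have h := add_mem (hstep (w i ^ (n : ℤ) * g)) ih
    rwa [sub_add_sub_cancel, ← mul_assoc, ← zpow_one_add, add_comm] at h
  | pred n ih =>
    have h := sub_mem ih (hstep (w i ^ (-(n : ℤ) - 1) * g))
    rwa [← mul_assoc, ← zpow_one_add, add_sub_cancel, sub_sub_sub_cancel_left] at h

theorem mapDomain_endpoints_eq_zero [DecidableEq B] [Finite B] (hmal : Malnormal B w)
    (hne : ∀ i, P i ≠ M i)
    (hP : ∀ i, TendstoBoundary B (fun k => w i ^ k) (P i))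
    (hM : ∀ i, TendstoBoundary B (fun k => (w i)⁻¹ ^ k) (M i)) {x : (Fin r × FreeGroup B) →₀ ℤ}
    (hx : ∀ ξ η, IsLine B w ξ η → pC1 B (lineIndicator P M) x ξ η = 0) :
    x.mapDomain (endpoints P M) = 0 := by
  ext ⟨ξ, η⟩
  by_cases h : (ξ, η) ∈ Set.range (endpoints P M)
  · obtain ⟨p, hp⟩ := h
    have hswap : (η, ξ) ∉ Set.range (endpoints P M) := by
      rintro ⟨q, hq⟩
      exact endpoints_ne_swap hmal hne hP hM q p (by rw [hq, hp, Prod.swap_prod_mk])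
    have h := hx ξ η ((isLine_iff hP hM).2 ⟨p, .inl hp⟩)
    rwa [pC1_lineIndicator, Finsupp.mapDomain_of_notMem_range _ _ hswap, sub_zero] at h
  · exact Finsupp.mapDomain_of_notMem_range _ _ h

theorem mem_relationSpan [DecidableEq B] [Finite B] (hmal : Malnormal B w) (hne : ∀ i, P i ≠ M i)
    (hP : ∀ i, TendstoBoundary B (fun k => w i ^ k) (P i))
    (hM : ∀ i, TendstoBoundary B (fun k => (w i)⁻¹ ^ k) (M i)) {x : (Fin r × FreeGroup B) →₀ ℤ}
    (hx : ∀ ξ η, IsLine B w ξ η → pC1 B (lineIndicator P M) x ξ η = 0) :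
    x ∈ relationSpan w := by
  let ρ := Set.rangeSplitting (endpoints P M) ∘ Set.rangeFactorization (endpoints P M)
  have hρ : ∀ p, endpoints P M p = endpoints P M (ρ p) := fun p =>
    (Set.apply_rangeSplitting (endpoints P M) (Set.rangeFactorization (endpoints P M) p)).symm
  have hzero : x.mapDomain ρ = 0 := by
    have h : x.mapDomain (Set.rangeFactorization (endpoints P M)) = 0 := by
      apply Finsupp.mapDomain_injective Subtype.val_injective
      rw [← Finsupp.mapDomain_comp, Finsupp.mapDomain_zero]
      exact mapDomain_endpoints_eq_zero hmal hne hP hM hx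
    rw [Finsupp.mapDomain_comp, h, Finsupp.mapDomain_zero]
  have hsub : ∀ x : (Fin r × FreeGroup B) →₀ ℤ, x - x.mapDomain ρ ∈ relationSpan w := by
    intro x
    induction x using Finsupp.induction_linear with
    | zero => simp
    | add x y hx hy =>
      rw [Finsupp.mapDomain_add, add_sub_add_comm]
      exact add_mem hx hy
    | single p n =>
      obtain ⟨i, g⟩ := p
      obtain ⟨h₁, z, h₂⟩ := exists_zpow_of_endpoints_eq (j := (ρ (i, g)).1) (h := (ρ (i, g)).2)
        hmal hP (hρ (i, g))
      have h := Submodule.smul_mem _ n (single_sub_single_mem_relationSpan (w := w) i (ρ (i, g)).2 z)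
      rw [← h₂] at h
      have hpair : ρ (i, g) = (i, (ρ (i, g)).2) := Prod.ext h₁.symm rfl
      rw [Finsupp.mapDomain_single, hpair]
      simpa [smul_sub] using h
  simpa [hzero] using hsub x

theorem exists_eq_sum_of_mem_relationSpan {x : (Fin r × FreeGroup B) →₀ ℤ}
    (hx : x ∈ relationSpan w) :
    ∃ (l : ℕ) (c : Fin l → ℤ) (j : Fin l → Fin r) (g : Fin l → FreeGroup B),
      x = ∑ i, c i • fsTranslate B (lineRelation w (j i)) (g i) := by
  obtain ⟨c, rfl⟩ := Finsupp.mem_span_range_iff_exists_finsupp.1 hx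
  let e := c.support.equivFin
  refine ⟨_, fun i => c (e.symm i).1, fun i => (e.symm i).1.1, fun i => (e.symm i).1.2, ?_⟩
  rw [Finsupp.sum, ← Finset.sum_coe_sort]
  exact (Equiv.sum_comp e.symm fun p : c.support =>
    c p.1 • fsTranslate B (lineRelation w p.1.1) p.1.2).symm

end Relations

end DecompPaper

open DecompPaper
/-- the right `ℤ[F]`-module `C¹` is finitely presented: there are
finitely many generators `F j ∈ C¹`, and the kernel of the induced map
`p : (ℤ[F])^k → C¹` is finitely generated as a `ℤ[F]`-module.  (Equalities between
elements of `C¹` are evaluated on oriented lines.) -/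
theorem first_cochains_finitely_presented
    (B : Type) [Fintype B] [DecidableEq B] (hB : 2 ≤ Fintype.card B)
    (r : ℕ) (w : Fin r → FreeGroup B) (hw : ∀ i, w i ≠ 1) (hmal : Malnormal B w) :
    ∃ (k : ℕ) (F : Fin k → Boundary B → Boundary B → ℤ),
      (∀ j, MemC1 B w (F j)) ∧
      (∀ f : Boundary B → Boundary B → ℤ, MemC1 B w f →
        ∃ x : (Fin k × FreeGroup B) →₀ ℤ,
          ∀ ξ η, IsLine B w ξ η → f ξ η = pC1 B F x ξ η) ∧
      ∃ (m : ℕ) (y : Fin m → (Fin k × FreeGroup B) →₀ ℤ),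
        (∀ i, ∀ ξ η, IsLine B w ξ η → pC1 B F (y i) ξ η = 0) ∧
        ∀ x : (Fin k × FreeGroup B) →₀ ℤ,
          (∀ ξ η, IsLine B w ξ η → pC1 B F x ξ η = 0) →
          ∃ (l : ℕ) (c : Fin l → ℤ) (j : Fin l → Fin m) (g : Fin l → FreeGroup B),
            x = ∑ i, c i • fsTranslate B (y (j i)) (g i) := by
  choose P M hne hP hM using fun i => exists_endpoints (hw i)
  exact ⟨r, lineIndicator P M, memC1_lineIndicator hne hP hM,
    fun f hf => exists_pC1_eq hmal hne hP hM hf, r, lineRelation w,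
    fun i ξ η _ => pC1_lineRelation hP hM i ξ η,
    fun x hx => exists_eq_sum_of_mem_relationSpan (mem_relationSpan hmal hne hP hM hx)⟩
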